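/- Base-case factorization in the proof of Theorem 3.1 (case y = 0): Let x,n be nonnegative integers, let U, D ⊆ [x+n] with |U∪D| = n, |U| = u, |D| = d, and let B ⊆ [x+n]\(U∪D). Then M(F_{x,0}(U;D;B)) = M(L_{2u, x+n−u}(U)) · M(L_{2d, x+n−d}(D)); that is, the region splits along the horizontal axis l into two quartered hexagons whose dents are given by U (above l) and by D (below l, after reflection over l). -/

import Mathlib

open Finset

/-- A unit triangle of the triangular lattice, in sheared coordinates:
`(true, a, j)` is the up-pointing triangle with horizontal base
`[a + j/2, a + 1 + j/2]` on the lattice line at height `j`;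
`(false, a, j)` is the down-pointing triangle with apex `(a + 1 + j/2, j)`
and top edge on the lattice line at height `j + 1`. -/
abbrev Tri : Type := Bool × ℤ × ℤ

def upT (a j : ℤ) : Tri := (true, a, j)
def dnT (a j : ℤ) : Tri := (false, a, j)

/-- A lozenge (union of two unit triangles sharing an edge), recorded by the
coordinates of its up-pointing triangle (first component) and of its
down-pointing triangle (second component). -/
abbrev Loz : Type := (ℤ × ℤ) × (ℤ × ℤ)

/-- The two triangles of a lozenge share an edge: the down-pointing triangle is
the right, left or lower neighbour of the up-pointing one. -/
def lozAdj (l : Loz) : Prop :=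
  l.2 = l.1 ∨ l.2 = (l.1.1 - 1, l.1.2) ∨ l.2 = (l.1.1, l.1.2 - 1)

/-- `T` is a lozenge tiling of the region `R`: it consists of lozenges lying in
`R` and covers every unit triangle of `R` exactly once. -/
def IsTiling (R : Finset Tri) (T : Finset Loz) : Prop :=
  (∀ l ∈ T, lozAdj l ∧ upT l.1.1 l.1.2 ∈ R ∧ dnT l.2.1 l.2.2 ∈ R) ∧
  (∀ t ∈ R, ∃! l, l ∈ T ∧ (t = upT l.1.1 l.1.2 ∨ t = dnT l.2.1 l.2.2))

/-- All lozenge tilings of `R` avoiding the forbidden lozenges in `F`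
(the barriers), collected in a finset. -/
noncomputable def tilings (R : Finset Tri) (F : Finset Loz) : Finset (Finset Loz) := by
  classical
  exact ((R.image Prod.snd ×ˢ R.image Prod.snd).powerset).filter
    (fun T => IsTiling R T ∧ ∀ l ∈ T, l ∉ F)

/-- `Mtil R F` : the number of lozenge tilings of `R` avoiding the barriers `F`. -/
noncomputable def Mtil (R : Finset Tri) (F : Finset Loz) : ℕ := (tilings R F).card

/-- Weighted tiling number: each lozenge in `Wt` carries weight `1/2`, all other
lozenges weight `1`; a tiling is weighted by the product of its lozenge weights. -/
noncomputable def Mw (R : Finset Tri) (F : Finset Loz) (Wt : Finset Loz) : ℚ :=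
  ∑ T ∈ tilings R F, (1 / 2 : ℚ) ^ (T ∩ Wt).card

/-- Reflection of a unit triangle over the horizontal lattice line `l` (height `0`). -/
def reflTri (t : Tri) : Tri :=
  if t.1 then (false, t.2.1 + t.2.2, -t.2.2 - 1) else (true, t.2.1 + t.2.2 + 1, -t.2.2 - 1)

/-- Reflection of a lozenge over the horizontal lattice line `l` (height `0`). -/
def reflLoz (l : Loz) : Loz :=
  ((l.2.1 + l.2.2 + 1, -l.2.2 - 1), (l.1.1 + l.1.2, -l.1.2 - 1))

/-- The up-pointing unit triangles removed at the positions of `U`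
(1-indexed, from left to right) just above the line `l`. -/
def upDents (U : Finset ℕ) : Finset Tri := U.image (fun (i : ℕ) => upT ((i : ℤ) - 1) 0)

/-- The down-pointing unit triangles removed at the positions of `D`
(1-indexed, from left to right) just below the line `l`. -/
def dnDents (D : Finset ℕ) : Finset Tri := D.image (fun (i : ℕ) => dnT ((i : ℤ) - 1) (-1))

/-- The vertical lozenges straddling the line `l` at the barrier positions `B`:
these are forbidden in any tiling. -/
def barrierLoz (B : Finset ℕ) : Finset Loz :=
  B.image (fun (i : ℕ) => (((i : ℤ) - 1, 0), ((i : ℤ) - 1, -1)))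

/-- The upper half of a hexagon: the semihexagon (trapezoid) with base `W` on the
line `l` and `h` rows of unit triangles above it. -/
def upperHex (W h : ℕ) : Finset Tri :=
  (Finset.range h).biUnion fun j =>
    ((Finset.range (W - j)).image fun (a : ℕ) => upT (a : ℤ) (j : ℤ)) ∪
    ((Finset.range (W - j - 1)).image fun (a : ℕ) => dnT (a : ℤ) (j : ℤ))

/-- The doubly-dented hexagon `H_{x,y}(U; D)` (with `n = |U ∪ D|` recorded
explicitly): the hexagon of side lengths `x+n-u, y+u, y+d, x+n-d, y+d, y+u`
(clockwise from the north side) with the up-pointing unit triangles at the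
positions of `U` and the down-pointing unit triangles at the positions of `D`
removed along the horizontal axis `l` through its west and east vertices. -/
def Hreg (x y n : ℕ) (U D : Finset ℕ) : Finset Tri :=
  (upperHex (x + y + n) (y + U.card) \ upDents U) ∪
  ((upperHex (x + y + n) (y + D.card)).image reflTri \ dnDents D)

/-- The quartered hexagon `L_{m,n}(A)`: the trapezoid whose northern,
northeastern, southern sides have lengths `n`, `m`, `n + ⌊(m+1)/2⌋` and whose
western side is a vertical zigzag of `m` steps, with the up-pointing unit
triangles at the positions of `A` removed from the base. -/
def Lreg (m n : ℕ) (A : Finset ℕ) : Finset Tri :=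
  ((Finset.range m).biUnion fun j =>
    ((Finset.range (n + (m + 1) / 2 + j / 2 - j)).image
        fun (a : ℕ) => upT ((a : ℤ) - ((j / 2 : ℕ) : ℤ)) (j : ℤ)) ∪
    ((Finset.range (n + (m + 1) / 2 + (j + 1) / 2 - (j + 1))).image
        fun (a : ℕ) => dnT ((a : ℤ) - (((j + 1) / 2 : ℕ) : ℤ)) (j : ℤ)))
  \ upDents A

/-- The vertical lozenges sitting along (the bumps of) the western zigzag side
of the quartered hexagon `L_{m,n}`; these get weight `1/2` in `L̄_{m,n}`. -/
def westLoz (m : ℕ) : Finset Loz :=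
  ((Finset.range m).filter fun j => j % 2 = 1).image fun j =>
    ((-(((j - 1) / 2 : ℕ) : ℤ), (j : ℤ)), (-(((j - 1) / 2 : ℕ) : ℤ), (j : ℤ) - 1))

/-- The doubly-dented halved hexagon `F_{x,y}(U; D)`: north, northeast,
southeast, south sides of lengths `x+n-u, 2y+2u, 2y+2d, x+n-d`, western side a
vertical zigzag with `4y+2u+2d` steps, with up-dents `U` and down-dents `D`
along the horizontal line `l` through the east vertex. -/
def Freg (x y n : ℕ) (U D : Finset ℕ) : Finset Tri :=
  Lreg (2 * y + 2 * U.card) (x + n - U.card) U ∪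
  (Lreg (2 * y + 2 * D.card) (x + n - D.card) D).image reflTri

/-- The doubly-dented halved hexagon `F̄_{x,y}(U; D)`: side lengths
`x+n-u, 2y-1+2u, 2y-1+2d, x+n-d` and a western zigzag with `4y+2u+2d-2` steps,
with up-dents `U` and down-dents `D` along the line `l` through the east vertex. -/
def Fbar (x y n : ℕ) (U D : Finset ℕ) : Finset Tri :=
  Lreg (2 * y + 2 * U.card - 1) (x + n - U.card) U ∪
  (Lreg (2 * y + 2 * D.card - 1) (x + n - D.card) D).image reflTri

/-- The weight-`1/2` vertical lozenges on the western side of `W_{x,y}(U;D;B)`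
(where `u = |U|`, `d = |D|`). -/
def wtW (y u d : ℕ) : Finset Loz :=
  westLoz (2 * y + 2 * u) ∪ (westLoz (2 * y + 2 * d)).image reflLoz

/-- The weight-`1/2` vertical lozenges on the western side of `W̄_{x,y}(U;D;B)`. -/
def wtWbar (y u d : ℕ) : Finset Loz :=
  westLoz (2 * y + 2 * u - 1) ∪ (westLoz (2 * y + 2 * d - 1)).image reflLoz

/-- `m - S = {m - s : s ∈ S}`. -/
def mirrorSet (m : ℕ) (S : Finset ℕ) : Finset ℕ := S.image fun i => m - i

/-- The reflectively symmetric doubly-dented hexagon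
`RS_{x,y}(U;D) = H_{x,y}(U ∪ ((x+y+2n+1)-U); D ∪ ((x+y+2n+1)-D))`. -/
def RSreg (x y n : ℕ) (U D : Finset ℕ) : Finset Tri :=
  Hreg x y (2 * n) (U ∪ mirrorSet (x + y + 2 * n + 1) U)
    (D ∪ mirrorSet (x + y + 2 * n + 1) D)

/-- Reflection of a lozenge over the vertical symmetry axis of a region whose
base on the line `l` spans the horizontal interval `[0, W]`. -/
def vreflLoz (W : ℤ) (l : Loz) : Loz :=
  ((W - 1 - l.1.1 - l.1.2, l.1.2), (W - 2 - l.2.1 - l.2.2, l.2.2))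

/-- The number of lozenge tilings of `R` (avoiding the barriers `F`) invariant
under the reflection over the vertical axis of a base of width `W`. -/
noncomputable def Msym (R : Finset Tri) (F : Finset Loz) (W : ℤ) : ℕ := by
  classical
  exact ((tilings R F).filter fun T => T.image (vreflLoz W) = T).card

/-- `M_r(RS_{x,y}(U;D;B))` : the number of reflectively symmetric lozenge
tilings of the symmetric doubly-dented hexagon with barriers at
`B ∪ ((x+y+2n+1)-B)`. -/
noncomputable def Mr (x y n : ℕ) (U D B : Finset ℕ) : ℕ :=
  Msym (RSreg x y n U D)
    (barrierLoz (B ∪ mirrorSet (x + y + 2 * n + 1) B))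
    ((x : ℤ) + (y : ℤ) + 2 * (n : ℤ))

/-- The skipping hyperfactorial: `H2 (2k) = 0! 2! ⋯ (2k-2)!` and
`H2 (2k+1) = 1! 3! ⋯ (2k-1)!`. -/
def H2 (n : ℕ) : ℕ :=
  ∏ j ∈ (Finset.range n).filter (fun j => j % 2 = n % 2), Nat.factorial j

/-- `∏_{1 ≤ i < j ≤ k} (s_j² - s_i²)` for the increasing enumeration
`s_1 < ⋯ < s_k` of `S`. -/
def prodDiffSq (S : Finset ℕ) : ℚ :=
  ∏ p ∈ S, ∏ q ∈ S.filter (fun q => p < q), ((q : ℚ) ^ 2 - (p : ℚ) ^ 2)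

/-- `∏_{1 ≤ i < j ≤ k} (s_j - s_i)`. -/
def prodDiff (S : Finset ℕ) : ℚ :=
  ∏ p ∈ S, ∏ q ∈ S.filter (fun q => p < q), ((q : ℚ) - (p : ℚ))

/-- `∏_{1 ≤ i < j ≤ k} (s_j - s_i)(s_j + s_i - 1)`. -/
def prodDS1 (S : Finset ℕ) : ℚ :=
  ∏ p ∈ S, ∏ q ∈ S.filter (fun q => p < q), (((q : ℚ) - (p : ℚ)) * ((q : ℚ) + (p : ℚ) - 1))

/-- `∏_{1 ≤ i < j ≤ k} (s_j - s_i)(s_j + s_i - 2)`. -/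
def prodDS2 (S : Finset ℕ) : ℚ :=
  ∏ p ∈ S, ∏ q ∈ S.filter (fun q => p < q), (((q : ℚ) - (p : ℚ)) * ((q : ℚ) + (p : ℚ) - 2))

/-- `∏_{1 ≤ i < j ≤ k} (s_i + s_j)`. -/
def prodSum0 (S : Finset ℕ) : ℚ :=
  ∏ p ∈ S, ∏ q ∈ S.filter (fun q => p < q), ((q : ℚ) + (p : ℚ))

/-- `∏_{1 ≤ i < j ≤ k} (s_i + s_j - 1)`. -/
def prodSum1 (S : Finset ℕ) : ℚ :=
  ∏ p ∈ S, ∏ q ∈ S.filter (fun q => p < q), ((q : ℚ) + (p : ℚ) - 1)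

/-- `∏_{1 ≤ i < j ≤ k} (s_i + s_j - 2)`. -/
def prodSum2 (S : Finset ℕ) : ℚ :=
  ∏ p ∈ S, ∏ q ∈ S.filter (fun q => p < q), ((q : ℚ) + (p : ℚ) - 2)

/-- `∏_{1 ≤ i ≤ j ≤ k} (s_i + s_j - 1)` (the diagonal `i = j` included). -/
def prodSumLe1 (S : Finset ℕ) : ℚ :=
  ∏ p ∈ S, ∏ q ∈ S.filter (fun q => p ≤ q), ((q : ℚ) + (p : ℚ) - 1)

theorem mem_tilings {R : Finset Tri} {F T : Finset Loz} :
    T ∈ tilings R F ↔ IsTiling R T ∧ ∀ l ∈ T, l ∉ F := by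
  classical
  simp only [tilings, Finset.mem_filter, Finset.mem_powerset, and_iff_right_iff_imp]
  rintro ⟨hT, -⟩ l hl
  obtain ⟨-, h1, h2⟩ := hT.1 l hl
  exact Finset.mem_product.2
    ⟨Finset.mem_image.2 ⟨_, h1, rfl⟩, Finset.mem_image.2 ⟨_, h2, rfl⟩⟩

/-- In a tiling, the lozenges whose up-pointing triangle satisfies `p` are equinumerous with the
up-pointing triangles of the region satisfying `p`. -/
theorem IsTiling.card_filter_up {R : Finset Tri} {T : Finset Loz} (hT : IsTiling R T)
    (p : ℤ × ℤ → Prop) [DecidablePred p] :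
    (T.filter fun l => p l.1).card = (R.filter fun t => t.1 = true ∧ p t.2).card := by
  refine Finset.card_nbij (fun l => upT l.1.1 l.1.2) ?_ ?_ ?_
  · intro l hl
    simp only [Finset.coe_filter, Set.mem_ofPred_eq] at hl ⊢
    exact ⟨(hT.1 l hl.1).2.1, rfl, hl.2⟩
  · intro l hl l' hl' h
    simp only [Finset.coe_filter, Set.mem_ofPred_eq] at hl hl'
    exact (hT.2 _ (hT.1 l hl.1).2.1).unique ⟨hl.1, Or.inl rfl⟩ ⟨hl'.1, Or.inl h⟩
  · rintro ⟨b, t⟩ ht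
    simp only [Finset.coe_filter, Set.mem_ofPred_eq] at ht
    obtain ⟨hR, rfl, hp⟩ := ht
    obtain ⟨l, ⟨hl, h⟩, -⟩ := hT.2 _ hR
    rcases h with h | h
    · have ht : t = l.1 := congrArg Prod.snd h
      exact ⟨l, by simpa [hl, ← ht] using hp, h.symm⟩
    · simp [dnT] at h

/-- In a tiling, the lozenges whose down-pointing triangle satisfies `p` are equinumerous with the
down-pointing triangles of the region satisfying `p`. -/
theorem IsTiling.card_filter_down {R : Finset Tri} {T : Finset Loz} (hT : IsTiling R T)
    (p : ℤ × ℤ → Prop) [DecidablePred p] :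
    (T.filter fun l => p l.2).card = (R.filter fun t => t.1 = false ∧ p t.2).card := by
  refine Finset.card_nbij (fun l => dnT l.2.1 l.2.2) ?_ ?_ ?_
  · intro l hl
    simp only [Finset.coe_filter, Set.mem_ofPred_eq] at hl ⊢
    exact ⟨(hT.1 l hl.1).2.2, rfl, hl.2⟩
  · intro l hl l' hl' h
    simp only [Finset.coe_filter, Set.mem_ofPred_eq] at hl hl'
    exact (hT.2 _ (hT.1 l hl.1).2.2).unique ⟨hl.1, Or.inr rfl⟩ ⟨hl'.1, Or.inr h⟩
  · rintro ⟨b, t⟩ ht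
    simp only [Finset.coe_filter, Set.mem_ofPred_eq] at ht
    obtain ⟨hR, rfl, hp⟩ := ht
    obtain ⟨l, ⟨hl, h⟩, -⟩ := hT.2 _ hR
    rcases h with h | h
    · simp [upT] at h
    · have ht : t = l.2 := congrArg Prod.snd h
      exact ⟨l, by simpa [hl, ← ht] using hp, h.symm⟩

/-- If the part of the region above the line `l` is balanced, no lozenge of a tiling
straddles `l`. -/
theorem IsTiling.down_nonneg_of_up_nonneg {R : Finset Tri} {T : Finset Loz} (hT : IsTiling R T)
    (hbal : (R.filter fun t => t.1 = true ∧ 0 ≤ t.2.2).card =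
      (R.filter fun t => t.1 = false ∧ 0 ≤ t.2.2).card)
    {l : Loz} (hl : l ∈ T) (h : 0 ≤ l.1.2) : 0 ≤ l.2.2 := by
  have hsub : (T.filter fun l => 0 ≤ l.2.2) ⊆ T.filter fun l => 0 ≤ l.1.2 := by
    intro k hk
    rw [Finset.mem_filter] at hk ⊢
    refine ⟨hk.1, ?_⟩
    rcases (hT.1 k hk.1).1 with h | h | h <;> have := hk.2 <;> rw [h] at this <;> grind
  have heq := Finset.eq_of_subset_of_card_le hsub <| le_of_eq <|
    (hT.card_filter_up fun t => 0 ≤ t.2).trans <|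
      hbal.trans (hT.card_filter_down fun t => 0 ≤ t.2).symm
  have hmem : l ∈ T.filter fun l => 0 ≤ l.1.2 := Finset.mem_filter.2 ⟨hl, h⟩
  rw [← heq] at hmem
  exact (Finset.mem_filter.1 hmem).2

/-- The lozenges of a tiling of `R` whose two triangles lie on the side `p` of a curve crossed by
no lozenge form a tiling of that part of `R`. -/
theorem IsTiling.filter {R : Finset Tri} {T : Finset Loz} (hT : IsTiling R T)
    (p : ℤ × ℤ → Prop) [DecidablePred p] (h : ∀ l ∈ T, p l.1 ↔ p l.2) :
    IsTiling (R.filter fun t => p t.2) (T.filter fun l => p l.2) := by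
  constructor
  · intro l hl
    rw [Finset.mem_filter] at hl
    obtain ⟨h0, h1, h2⟩ := hT.1 l hl.1
    exact ⟨h0, Finset.mem_filter.2 ⟨h1, (h l hl.1).2 hl.2⟩, Finset.mem_filter.2 ⟨h2, hl.2⟩⟩
  · intro t ht
    rw [Finset.mem_filter] at ht
    obtain ⟨l, ⟨hl, hlt⟩, huniq⟩ := hT.2 t ht.1
    refine ⟨l, ⟨Finset.mem_filter.2 ⟨hl, ?_⟩, hlt⟩, fun k hk =>
      huniq k ⟨(Finset.mem_filter.1 hk.1).1, hk.2⟩⟩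
    rcases hlt with rfl | rfl
    · exact (h l hl).1 ht.2
    · exact ht.2

theorem IsTiling.union {A B : Finset Tri} {S T : Finset Loz} (hS : IsTiling A S)
    (hT : IsTiling B T) (hAB : Disjoint A B) : IsTiling (A ∪ B) (S ∪ T) := by
  have key : ∀ {A' B' : Finset Tri} {S' T' : Finset Loz}, IsTiling A' S' → IsTiling B' T' →
      Disjoint A' B' → ∀ t ∈ A', ∃! l, (l ∈ S' ∨ l ∈ T') ∧
        (t = upT l.1.1 l.1.2 ∨ t = dnT l.2.1 l.2.2) := by
    intro A' B' S' T' hS' hT' hd t ht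
    obtain ⟨l, ⟨hl, hlt⟩, huniq⟩ := hS'.2 t ht
    refine ⟨l, ⟨Or.inl hl, hlt⟩, ?_⟩
    rintro k ⟨hk | hk, hkt⟩
    · exact huniq k ⟨hk, hkt⟩
    · obtain ⟨-, h1, h2⟩ := hT'.1 k hk
      refine (Finset.disjoint_left.1 hd ht ?_).elim
      rcases hkt with rfl | rfl
      · exact h1
      · exact h2
  constructor
  · intro l hl
    simp only [Finset.mem_union]
    rcases Finset.mem_union.1 hl with hl | hl
    · obtain ⟨h0, h1, h2⟩ := hS.1 l hl
      exact ⟨h0, Or.inl h1, Or.inl h2⟩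
    · obtain ⟨h0, h1, h2⟩ := hT.1 l hl
      exact ⟨h0, Or.inr h1, Or.inr h2⟩
  · intro t ht
    simp only [Finset.mem_union]
    rcases Finset.mem_union.1 ht with ht | ht
    · exact key hS hT hAB t ht
    · simpa only [or_comm] using key hT hS hAB.symm t ht

/-- A region whose part `A` above the line `l` is balanced splits along `l`, regardless of
barriers placed on `l`. -/
theorem Mtil_union_of_balanced {A B : Finset Tri} {F : Finset Loz}
    (hA : ∀ t ∈ A, 0 ≤ t.2.2) (hB : ∀ t ∈ B, t.2.2 < 0)
    (hbal : (A.filter fun t => t.1 = true).card = (A.filter fun t => t.1 = false).card)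
    (hF : ∀ l ∈ F, 0 ≤ l.1.2 ∧ l.2.2 < 0) :
    Mtil (A ∪ B) F = Mtil A ∅ * Mtil B ∅ := by
  have hdisj : Disjoint A B :=
    Finset.disjoint_left.2 fun t h1 h2 => absurd (hA t h1) (not_le.2 (hB t h2))
  have hfA : ((A ∪ B).filter fun t => 0 ≤ t.2.2) = A := by
    ext t
    have := hA t
    have := hB t
    grind
  have hfB : ((A ∪ B).filter fun t => ¬ 0 ≤ t.2.2) = B := by
    ext t
    have := hA t
    have := hB t
    grind
  have hbal' : ((A ∪ B).filter fun t => t.1 = true ∧ 0 ≤ t.2.2).card =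
      ((A ∪ B).filter fun t => t.1 = false ∧ 0 ≤ t.2.2).card := by
    simp only [and_comm (b := (0 : ℤ) ≤ _)]
    rw [← Finset.filter_filter, ← Finset.filter_filter, hfA, hbal]
  have hside : ∀ {T}, IsTiling (A ∪ B) T → ∀ l ∈ T, (0 ≤ l.1.2 ↔ 0 ≤ l.2.2) := by
    intro T hT l hl
    refine ⟨hT.down_nonneg_of_up_nonneg hbal' hl, fun h => ?_⟩
    rcases (hT.1 l hl).1 with e | e | e <;> rw [e] at h <;> grind
  unfold Mtil
  rw [← Finset.card_product]
  refine Finset.card_nbij'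
    (fun T => (T.filter fun l => 0 ≤ l.2.2, T.filter fun l => ¬ 0 ≤ l.2.2))
    (fun P => P.1 ∪ P.2) ?_ ?_ ?_ ?_
  · intro T hT
    rw [Finset.mem_coe, mem_tilings] at hT
    rw [Finset.mem_coe, Finset.mem_product, mem_tilings, mem_tilings]
    have h1 := hT.1.filter (fun t => 0 ≤ t.2) (hside hT.1)
    have h2 := hT.1.filter (fun t => ¬ 0 ≤ t.2) fun l hl => not_congr (hside hT.1 l hl)
    rw [hfA] at h1
    rw [hfB] at h2
    exact ⟨⟨h1, by simp⟩, ⟨h2, by simp⟩⟩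
  · rintro ⟨S, T⟩ h
    rw [Finset.mem_coe, Finset.mem_product, mem_tilings, mem_tilings] at h
    obtain ⟨⟨hS, -⟩, ⟨hT, -⟩⟩ := h
    rw [Finset.mem_coe, mem_tilings]
    refine ⟨hS.union hT hdisj, fun l hl hlF => ?_⟩
    rcases Finset.mem_union.1 hl with hl | hl
    · exact absurd (hA _ (hS.1 l hl).2.2) (not_le.2 (hF l hlF).2)
    · exact absurd (hF l hlF).1 (not_le.2 (hB _ (hT.1 l hl).2.1))
  · intro T _
    exact Finset.filter_union_filter_not_eq _ _
  · rintro ⟨S, T⟩ h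
    rw [Finset.mem_coe, Finset.mem_product, mem_tilings, mem_tilings] at h
    obtain ⟨⟨hS, -⟩, ⟨hT, -⟩⟩ := h
    have h1 : ∀ l ∈ S, 0 ≤ l.2.2 := fun l hl => hA _ (hS.1 l hl).2.2
    have h2 : ∀ l ∈ T, l.2.2 < 0 := fun l hl => hB _ (hT.1 l hl).2.2
    ext l
    · have := h1 l
      have := h2 l
      grind
    · have := h1 l
      have := h2 l
      grind

theorem reflTri_involutive : Function.Involutive reflTri := by
  rintro ⟨b, a, j⟩
  cases b <;> simp [reflTri]
  ring

theorem reflLoz_involutive : Function.Involutive reflLoz := by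
  rintro ⟨⟨a, j⟩, ⟨b, k⟩⟩
  simp [reflLoz]
  ring

theorem reflTri_upT (l : Loz) :
    reflTri (upT l.1.1 l.1.2) = dnT (reflLoz l).2.1 (reflLoz l).2.2 := rfl

theorem reflTri_dnT (l : Loz) :
    reflTri (dnT l.2.1 l.2.2) = upT (reflLoz l).1.1 (reflLoz l).1.2 := rfl

theorem lozAdj.reflLoz {l : Loz} (h : lozAdj l) : lozAdj (reflLoz l) := by
  obtain ⟨⟨a, j⟩, ⟨b, k⟩⟩ := l
  simp only [lozAdj, _root_.reflLoz, Prod.mk.injEq] at h ⊢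
  omega

theorem IsTiling.reflect {R : Finset Tri} {T : Finset Loz} (hT : IsTiling R T) :
    IsTiling (R.image reflTri) (T.image reflLoz) := by
  constructor
  · intro l hl
    obtain ⟨k, hk, rfl⟩ := Finset.mem_image.1 hl
    obtain ⟨h0, h1, h2⟩ := hT.1 k hk
    exact ⟨h0.reflLoz, reflTri_dnT k ▸ Finset.mem_image_of_mem _ h2,
      reflTri_upT k ▸ Finset.mem_image_of_mem _ h1⟩
  · intro t ht
    obtain ⟨s, hs, rfl⟩ := Finset.mem_image.1 ht
    obtain ⟨l, ⟨hl, hlt⟩, huniq⟩ := hT.2 s hs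
    refine ⟨reflLoz l, ⟨Finset.mem_image_of_mem _ hl, ?_⟩, ?_⟩
    · rw [← reflTri_upT, ← reflTri_dnT, reflTri_involutive.injective.eq_iff,
        reflTri_involutive.injective.eq_iff]
      exact hlt.symm
    · rintro k ⟨hk, hkt⟩
      obtain ⟨k, hk', rfl⟩ := Finset.mem_image.1 hk
      rw [← reflTri_upT, ← reflTri_dnT, reflTri_involutive.injective.eq_iff,
        reflTri_involutive.injective.eq_iff] at hkt
      rw [huniq k ⟨hk', hkt.symm⟩]

theorem Mtil_image_reflTri (R : Finset Tri) : Mtil (R.image reflTri) ∅ = Mtil R ∅ := by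
  have hR : (R.image reflTri).image reflTri = R := by
    simp [Finset.image_image, reflTri_involutive.comp_self]
  have hL (T : Finset Loz) : (T.image reflLoz).image reflLoz = T := by
    simp [Finset.image_image, reflLoz_involutive.comp_self]
  refine Finset.card_nbij' (Finset.image reflLoz) (Finset.image reflLoz) ?_ ?_
    (fun T _ => hL T) (fun T _ => hL T)
  · intro T hT
    rw [Finset.mem_coe, mem_tilings] at hT ⊢
    exact ⟨hR ▸ hT.1.reflect, by simp⟩
  · intro T hT
    rw [Finset.mem_coe, mem_tilings] at hT ⊢
    exact ⟨hT.1.reflect, by simp⟩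

theorem nonneg_of_mem_Lreg {m n : ℕ} {A : Finset ℕ} {t : Tri} (ht : t ∈ Lreg m n A) :
    0 ≤ t.2.2 := by
  simp only [Lreg, Finset.mem_sdiff, Finset.mem_biUnion, Finset.mem_union,
    Finset.mem_image] at ht
  obtain ⟨⟨j, -, ⟨a, -, rfl⟩ | ⟨a, -, rfl⟩⟩, -⟩ := ht <;> exact Int.natCast_nonneg j

theorem neg_of_mem_image_reflTri {R : Finset Tri} (hR : ∀ t ∈ R, 0 ≤ t.2.2) :
    ∀ t ∈ R.image reflTri, t.2.2 < 0 := by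
  intro t ht
  obtain ⟨⟨b, a, j⟩, hs, rfl⟩ := Finset.mem_image.1 ht
  have : 0 ≤ j := hR _ hs
  cases b <;> simp only [reflTri] <;> simp <;> omega

theorem card_biUnion_rows (m : ℕ) (w s : ℕ → ℕ) (b : Bool) :
    ((Finset.range m).biUnion fun j => (Finset.range (w j)).image
      fun (a : ℕ) => ((b, (a : ℤ) - (s j : ℤ), (j : ℤ)) : Tri)).card =
      ∑ j ∈ Finset.range m, w j := by
  rw [Finset.card_biUnion]
  · refine Finset.sum_congr rfl fun j _ => ?_
    rw [Finset.card_image_of_injective, Finset.card_range]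
    intro a a' h
    simpa using h
  · intro i _ j _ hij
    refine Finset.disjoint_left.2 fun t h1 h2 => hij ?_
    obtain ⟨a, -, rfl⟩ := Finset.mem_image.1 h1
    obtain ⟨a', -, h⟩ := Finset.mem_image.1 h2
    simp only [Prod.mk.injEq, Nat.cast_inj] at h
    exact h.2.2.symm

/-- A quartered hexagon with an admissible set of dents has as many up-pointing as down-pointing
unit triangles. -/
theorem Lreg_balanced {u n : ℕ} {U : Finset ℕ} (hU : U.card = u)
    (hsub : U ⊆ Finset.Icc 1 (n + u)) :
    ((Lreg (2 * u) n U).filter fun t => t.1 = true).card =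
      ((Lreg (2 * u) n U).filter fun t => t.1 = false).card := by
  have hhalf : (2 * u + 1) / 2 = u := by omega
  have hup : ((Lreg (2 * u) n U).filter fun t => t.1 = true) =
      ((Finset.range (2 * u)).biUnion fun j => (Finset.range (n + u + j / 2 - j)).image
        fun (a : ℕ) => ((true, (a : ℤ) - ((j / 2 : ℕ) : ℤ), (j : ℤ)) : Tri)) \ upDents U := by
    ext ⟨b, t⟩
    cases b <;> simp [Lreg, upT, dnT, hhalf]
  have hdn : ((Lreg (2 * u) n U).filter fun t => t.1 = false) =
      (Finset.range (2 * u)).biUnion fun j =>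
        (Finset.range (n + u + (j + 1) / 2 - (j + 1))).image
        fun (a : ℕ) => ((false, (a : ℤ) - (((j + 1) / 2 : ℕ) : ℤ), (j : ℤ)) : Tri) := by
    ext ⟨b, t⟩
    cases b <;> simp [Lreg, upT, dnT, upDents, hhalf]
  have hdents : (upDents U).card = u := by
    rw [upDents, Finset.card_image_of_injective, hU]
    intro a a' h
    simpa [upT] using h
  have hdsub : upDents U ⊆ (Finset.range (2 * u)).biUnion fun j =>
      (Finset.range (n + u + j / 2 - j)).image
        fun (a : ℕ) => ((true, (a : ℤ) - ((j / 2 : ℕ) : ℤ), (j : ℤ)) : Tri) := by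
    intro t ht
    obtain ⟨i, hi, rfl⟩ := Finset.mem_image.1 ht
    have hpos : 0 < U.card := Finset.card_pos.2 ⟨i, hi⟩
    have hi' := Finset.mem_Icc.1 (hsub hi)
    refine Finset.mem_biUnion.2 ⟨0, Finset.mem_range.2 (by omega),
      Finset.mem_image.2 ⟨i - 1, Finset.mem_range.2 (by omega), ?_⟩⟩
    simp [upT, Nat.cast_sub hi'.1]
  rw [hup, hdn, Finset.card_sdiff_of_subset hdsub, hdents,
    card_biUnion_rows _ (fun j => n + u + j / 2 - j) (fun j => j / 2),
    card_biUnion_rows _ (fun j => n + u + (j + 1) / 2 - (j + 1)) (fun j => (j + 1) / 2)]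
  have h1 := Finset.sum_range_succ (fun j => n + u + j / 2 - j) (2 * u)
  rw [Finset.sum_range_succ'] at h1
  simp only [Nat.zero_div, add_zero, tsub_zero] at h1
  omega

/-- **Base-case factorization in the proof of Theorem 3.1** (case `y = 0`):
the halved hexagon `F_{x,0}(U;D;B)` splits along `l` into the two quartered
hexagons `L_{2u, x+n-u}(U)` and `L_{2d, x+n-d}(D)`. -/
theorem base_case_split_F
    (x n u d : ℕ) (U D B : Finset ℕ)
    (hUc : U.card = u) (hDc : D.card = d)
    (hUsub : U ⊆ Finset.Icc 1 (x + n)) (hDsub : D ⊆ Finset.Icc 1 (x + n))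
    (hn : (U ∪ D).card = n)
    (hBsub : B ⊆ Finset.Icc 1 (x + n) \ (U ∪ D)) :
    Mtil (Freg x 0 n U D) (barrierLoz B) =
      Mtil (Lreg (2 * u) (x + n - u) U) ∅ * Mtil (Lreg (2 * d) (x + n - d) D) ∅ := by
  subst hUc hDc
  have hU : U.card ≤ n := hn ▸ Finset.card_le_card Finset.subset_union_left
  have hF : Freg x 0 n U D = Lreg (2 * U.card) (x + n - U.card) U ∪
      (Lreg (2 * D.card) (x + n - D.card) D).image reflTri := by
    simp [Freg]
  rw [hF, ← Mtil_image_reflTri (Lreg (2 * D.card) (x + n - D.card) D)]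
  refine Mtil_union_of_balanced (fun t => nonneg_of_mem_Lreg)
    (neg_of_mem_image_reflTri fun t => nonneg_of_mem_Lreg)
    (Lreg_balanced rfl ?_) ?_
  · rwa [Nat.sub_add_cancel (hU.trans (Nat.le_add_left n x))]
  · intro l hl
    obtain ⟨i, -, rfl⟩ := Finset.mem_image.1 hl
    simp
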